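/- The map sending an achievable permutation p of length n to the pair (q, c), where q is the increment-avoiding permutation obtained by repeatedly contracting adjacent entries a_j, a_{j+1} with a_{j+1} = a_j + 1, and c is the composition of n recording the lengths of the contracted runs, is a bijection between achievable permutations of length n and pairs consisting of an increment-avoiding achievable permutation of length i (for some 1 ≤ i ≤ n) together with a composition of n into i positive parts. -/

import Mathlib

namespace TwoStacks

/-- A state of the two-stacks-in-series machine: remaining input,
stack 1, stack 2 (tops at the head), and the output so far. -/
structure St where
  inp : List ℕ
  s1 : List ℕ
  s2 : List ℕ
  out : List ℕ
deriving DecidableEq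

/-- The three moves. -/
inductive Mv
  | rho  -- input → stack 1
  | lam  -- stack 1 → stack 2
  | mu   -- stack 2 → output
deriving DecidableEq

/-- One move of the machine (`none` if the move is not applicable). -/
def step : Mv → St → Option St
  | .rho, ⟨x :: xs, s1, s2, o⟩ => some ⟨xs, x :: s1, s2, o⟩
  | .lam, ⟨i, x :: xs, s2, o⟩ => some ⟨i, xs, x :: s2, o⟩
  | .mu,  ⟨i, s1, x :: xs, o⟩ => some ⟨i, s1, xs, o ++ [x]⟩
  | _, _ => none

/-- Run a word of moves on a state. -/
def run (w : List Mv) (s : St) : Option St :=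
  w.foldlM (fun s m => step m s) s

/-- The list 1,2,…,n. -/
def idSeq (n : ℕ) : List ℕ := (List.range n).map (· + 1)

/-- The one-line notation p(1),…,p(n) (values in {1,…,n}) of a permutation. -/
def permList {n : ℕ} (p : Equiv.Perm (Fin n)) : List ℕ :=
  List.ofFn fun i => (p i : ℕ) + 1

/-- p is achievable: from input 1,…,n some word of moves outputs p(1),…,p(n). -/
def Achievable {n : ℕ} (p : Equiv.Perm (Fin n)) : Prop :=
  ∃ w, run w ⟨idSeq n, [], [], []⟩ = some ⟨[], [], [], permList p⟩

/-- p is sortable: from input p(1),…,p(n) some word of moves outputs 1,…,n. -/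
def Sortable {n : ℕ} (p : Equiv.Perm (Fin n)) : Prop :=
  ∃ w, run w ⟨permList p, [], [], []⟩ = some ⟨[], [], [], idSeq n⟩

/-- A list of (distinct) naturals is achievable as an output. -/
def AchList (l : List ℕ) : Prop :=
  ∃ w, run w ⟨idSeq l.length, [], [], []⟩ = some ⟨[], [], [], l⟩

/-- Standardization (pattern) of a list with distinct entries:
each entry is replaced by its rank (1-based). -/
def std (l : List ℕ) : List ℕ :=
  l.map fun x => (l.filter (· ≤ x)).length

/-- An operation sequence of length 3n: n of each letter, and every
prefix has #ρ ≥ #λ ≥ #μ. -/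
def OpSeq (n : ℕ) (w : List Mv) : Prop :=
  w.length = 3 * n ∧ w.count .rho = n ∧ w.count .lam = n ∧ w.count .mu = n ∧
  ∀ u, u <+: w → u.count .mu ≤ u.count .lam ∧ u.count .lam ≤ u.count .rho

/-- An x,y-Catalan word: word over {x,y} with equally many x's and y's
in which every prefix has at least as many x's as y's. -/
def CatWord (x y : Mv) (w : List Mv) : Prop :=
  (∀ m ∈ w, m = x ∨ m = y) ∧ w.count x = w.count y ∧
  ∀ u, u <+: w → u.count y ≤ u.count x

/-- Two words have the same effect: applied to any state on which both
are applicable, they give the same resulting state. -/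
def SameEffect (v v' : List Mv) : Prop :=
  ∀ s t t', run v s = some t → run v' s = some t' → t = t'

/-- Rank of a letter for the order ρ < λ < μ. -/
def rk : Mv → ℕ
  | .rho => 0
  | .lam => 1
  | .mu => 2

/-- The order ρ < λ < μ on letters. -/
def mlt (a b : Mv) : Prop := rk a < rk b

/-- Lexicographic order on words induced by ρ < λ < μ. -/
def wordLt (v v' : List Mv) : Prop := List.Lex mlt v v'

/-- No entry is immediately followed by its successor. -/
def IncAvoid (l : List ℕ) : Prop :=
  ∀ j (h : j + 1 < l.length), l.get ⟨j + 1, h⟩ ≠ l.get ⟨j, by omega⟩ + 1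

/-- Expansion: replace each entry of `q` (paired with part `c_k`) by a run of
`c_k` consecutive integers; the run for the entry of value `v` starts just
after the total length of the runs of all smaller entries. -/
def expand (q c : List ℕ) : List ℕ :=
  (q.zip c).flatMap fun vc =>
    (List.range vc.2).map fun r =>
      (((q.zip c).filter fun vc' => decide (vc'.1 < vc.1)).map Prod.snd).sum + r + 1

/-- Replace every symbol `x` in a state by the block `f x`; blocks are stored reversed
in the first stack. -/
def St.substitute (f : ℕ → List ℕ) (s : St) : St :=
  ⟨s.inp.flatMap f, s.s1.flatMap fun x => (f x).reverse, s.s2.flatMap f, s.out.flatMap f⟩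

lemma run_append (v w : List Mv) (s : St) : run (v ++ w) s = (run v s).bind (run w) := by
  simp only [run, List.foldlM_append]
  rfl

lemma run_cons (m : Mv) (w : List Mv) (s : St) : run (m :: w) s = (step m s).bind (run w) := rfl

lemma run_replicate_rho (b i s1 s2 o : List ℕ) :
    run (List.replicate b.length .rho) ⟨b ++ i, s1, s2, o⟩ = some ⟨i, b.reverse ++ s1, s2, o⟩ := by
  induction b generalizing s1 with
  | nil => rfl
  | cons x b ih => simp [List.replicate_succ, run_cons, step, ih]

lemma run_replicate_lam (b i s1 s2 o : List ℕ) :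
    run (List.replicate b.length .lam) ⟨i, b ++ s1, s2, o⟩ = some ⟨i, s1, b.reverse ++ s2, o⟩ := by
  induction b generalizing s2 with
  | nil => rfl
  | cons x b ih => simp [List.replicate_succ, run_cons, step, ih]

lemma run_replicate_mu (b i s1 s2 o : List ℕ) :
    run (List.replicate b.length .mu) ⟨i, s1, b ++ s2, o⟩ = some ⟨i, s1, s2, o ++ b⟩ := by
  induction b generalizing o with
  | nil => simp [run]
  | cons x b ih => simp [List.replicate_succ, run_cons, step, ih]

lemma exists_run_substitute_of_step (f : ℕ → List ℕ) (m : Mv) (s t : St) (h : step m s = some t) :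
    ∃ w, run w (s.substitute f) = some (t.substitute f) := by
  obtain ⟨i, s1, s2, o⟩ := s
  cases m with
  | rho =>
    rcases i with _ | ⟨x, i⟩
    · simp [step] at h
    · simp only [step, Option.some.injEq] at h
      subst h
      exact ⟨_, run_replicate_rho (f x) _ _ _ _⟩
  | lam =>
    rcases s1 with _ | ⟨x, s1⟩
    · simp [step] at h
    · simp only [step, Option.some.injEq] at h
      subst h
      refine ⟨_, (run_replicate_lam (f x).reverse _ _ _ _).trans ?_⟩
      simp [St.substitute, List.flatMap_def]
  | mu =>
    rcases s2 with _ | ⟨x, s2⟩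
    · simp [step] at h
    · simp only [step, Option.some.injEq] at h
      subst h
      refine ⟨_, (run_replicate_mu (f x) _ _ _ _).trans ?_⟩
      simp [St.substitute, List.flatMap_def]

/-- Substituting blocks (possibly empty) for symbols preserves reachability. -/
lemma exists_run_substitute (f : ℕ → List ℕ) (w : List Mv) (s t : St) (h : run w s = some t) :
    ∃ w', run w' (s.substitute f) = some (t.substitute f) := by
  induction w generalizing s with
  | nil =>
    obtain rfl : s = t := by simpa [run] using h
    exact ⟨[], rfl⟩
  | cons m w ih =>
    rw [run_cons, Option.bind_eq_some_iff] at h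
    obtain ⟨u, hu, h⟩ := h
    obtain ⟨w₁, h₁⟩ := exists_run_substitute_of_step f m s u hu
    obtain ⟨w₂, h₂⟩ := ih u h
    exact ⟨w₁ ++ w₂, by rw [run_append, h₁, Option.bind_some, h₂]⟩

lemma AchList.flatMap {l : List ℕ} (h : AchList l) (f : ℕ → List ℕ)
    (hf : (idSeq l.length).flatMap f = idSeq (l.flatMap f).length) : AchList (l.flatMap f) := by
  obtain ⟨w, hw⟩ := h
  obtain ⟨w', hw'⟩ := exists_run_substitute f w _ _ hw
  exact ⟨w', by simpa [St.substitute, hf] using hw'⟩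

lemma idSeq_eq_range' (n : ℕ) : idSeq n = List.range' 1 n := by
  simp [idSeq, List.range'_eq_map_range, Nat.add_comm]

lemma length_idSeq (n : ℕ) : (idSeq n).length = n := by simp [idSeq]

lemma mem_idSeq {n x : ℕ} : x ∈ idSeq n ↔ 1 ≤ x ∧ x ≤ n := by
  rw [idSeq_eq_range', List.mem_range'_1]
  omega

lemma nodup_idSeq (n : ℕ) : (idSeq n).Nodup := by
  rw [idSeq_eq_range']
  exact List.nodup_range'

lemma pairwise_idSeq (n : ℕ) : (idSeq n).Pairwise (· < ·) := by
  rw [idSeq_eq_range']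
  exact List.pairwise_lt_range'

/-- The total size of the parts attached to values smaller than `v`. -/
def offset (P : List (ℕ × ℕ)) (v : ℕ) : ℕ :=
  ((P.filter fun p => decide (p.1 < v)).map Prod.snd).sum

lemma expand_eq (q c : List ℕ) : expand q c =
    (q.zip c).flatMap fun p => List.range' (offset (q.zip c) p.1 + 1) p.2 := by
  unfold expand
  congr 1
  funext p
  rw [List.range'_eq_map_range]
  apply List.map_congr_left
  intro r _
  simp only [offset]
  omega

lemma offset_cons (a : ℕ × ℕ) (P : List (ℕ × ℕ)) (v : ℕ) :
    offset (a :: P) v = (if a.1 < v then a.2 else 0) + offset P v := by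
  unfold offset
  by_cases h : a.1 < v <;> simp [h]

lemma offset_mono (P : List (ℕ × ℕ)) : Monotone (offset P) := by
  intro u v huv
  induction P with
  | nil => simp [offset]
  | cons a P ih =>
    simp only [offset_cons]
    split_ifs <;> omega

lemma offset_succ_of_notMem {P : List (ℕ × ℕ)} {v : ℕ} (h : v ∉ P.map Prod.fst) :
    offset P (v + 1) = offset P v := by
  induction P with
  | nil => simp [offset]
  | cons a P ih =>
    simp only [List.map_cons, List.mem_cons, not_or] at h
    simp only [offset_cons, ih h.2]
    split_ifs <;> omega

lemma offset_succ {P : List (ℕ × ℕ)} (hP : (P.map Prod.fst).Nodup) {p : ℕ × ℕ} (hp : p ∈ P) :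
    offset P (p.1 + 1) = offset P p.1 + p.2 := by
  induction P with
  | nil => simp at hp
  | cons a P ih =>
    simp only [List.map_cons, List.nodup_cons] at hP
    simp only [offset_cons]
    rcases List.mem_cons.1 hp with rfl | hp
    · rw [offset_succ_of_notMem hP.1]
      simp [Nat.add_comm]
    · have : a.1 ≠ p.1 := fun h => hP.1 (h ▸ List.mem_map_of_mem hp)
      rw [ih hP.2 hp]
      split_ifs <;> omega

lemma offset_eq_sum {P : List (ℕ × ℕ)} {v : ℕ} (h : ∀ x ∈ P.map Prod.fst, x < v) :
    offset P v = (P.map Prod.snd).sum := by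
  unfold offset
  rw [List.filter_eq_self.2]
  intro p hp
  simpa using h _ (List.mem_map_of_mem hp)

lemma offset_eq_zero {P : List (ℕ × ℕ)} {v : ℕ} (h : ∀ x ∈ P.map Prod.fst, v ≤ x) :
    offset P v = 0 := by
  unfold offset
  rw [List.filter_eq_nil_iff.2]
  · rfl
  intro p hp
  simpa using h _ (List.mem_map_of_mem hp)

lemma flatMap_range'_of_monotone {F : ℕ → ℕ} (hF : Monotone F) (a k : ℕ) :
    (List.range' a k).flatMap (fun v => List.range' (F v + 1) (F (v + 1) - F v)) =
      List.range' (F a + 1) (F (a + k) - F a) := by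
  induction k generalizing a with
  | zero => simp
  | succ k ih =>
    have h₁ := hF (Nat.le_add_right a 1)
    have h₂ := hF (Nat.le_add_right (a + 1) k)
    rw [List.range'_succ, List.flatMap_cons, ih]
    have e : F (a + 1) + 1 = F a + 1 + 1 * (F (a + 1) - F a) := by omega
    rw [e, List.range'_append, show a + 1 + k = a + (k + 1) by omega]
    congr 1
    rw [show a + 1 + k = a + (k + 1) by omega] at h₂
    omega

lemma expand_eq_flatMap {q c : List ℕ} (hq : q.Nodup) (hl : q.length = c.length) :
    expand q c = q.flatMap fun v => List.range' (offset (q.zip c) v + 1)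
      (offset (q.zip c) (v + 1) - offset (q.zip c) v) := by
  have hfst : (q.zip c).map Prod.fst = q := List.map_fst_zip hl.le
  rw [expand_eq]
  conv_rhs => rw [← hfst, List.flatMap_map, hfst]
  refine List.flatMap_congr fun p hp => ?_
  rw [offset_succ (by rwa [hfst]) hp, Nat.add_sub_cancel_left]

lemma flatMap_idSeq_offset {q c : List ℕ} (hq : q.Perm (idSeq q.length))
    (hl : q.length = c.length) :
    ((idSeq q.length).flatMap fun v => List.range' (offset (q.zip c) v + 1)
      (offset (q.zip c) (v + 1) - offset (q.zip c) v)) = idSeq c.sum := by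
  have hfst : (q.zip c).map Prod.fst = q := List.map_fst_zip hl.le
  have hsnd : (q.zip c).map Prod.snd = c := List.map_snd_zip hl.ge
  have hmem : ∀ x ∈ q, 1 ≤ x ∧ x ≤ q.length := fun x hx => mem_idSeq.1 (hq.mem_iff.1 hx)
  rw [idSeq_eq_range', flatMap_range'_of_monotone (offset_mono _), idSeq_eq_range',
    offset_eq_zero (v := 1), offset_eq_sum (v := 1 + q.length), hsnd]
  · simp
  · intro x hx
    rw [hfst] at hx
    have := hmem x hx
    omega
  · intro x hx
    rw [hfst] at hx
    exact (hmem x hx).1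

lemma expand_perm {q c : List ℕ} (hq : q.Perm (idSeq q.length)) (hl : q.length = c.length) :
    (expand q c).Perm (idSeq c.sum) := by
  rw [expand_eq_flatMap (hq.nodup_iff.2 (nodup_idSeq _)) hl, ← flatMap_idSeq_offset hq hl]
  exact hq.flatMap_right _

lemma achList_expand {q c : List ℕ} (ha : AchList q) (hq : q.Perm (idSeq q.length))
    (hl : q.length = c.length) : AchList (expand q c) := by
  have hlen := (expand_perm hq hl).length_eq
  rw [length_idSeq] at hlen
  rw [expand_eq_flatMap (hq.nodup_iff.2 (nodup_idSeq _)) hl] at hlen ⊢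
  refine ha.flatMap _ ?_
  rw [hlen, flatMap_idSeq_offset hq hl]

/-- The number of entries of `l` that are at most `x`. -/
def rank (l : List ℕ) (x : ℕ) : ℕ := (l.filter fun y => decide (y ≤ x)).length

lemma std_eq_map_rank (l : List ℕ) : std l = l.map (rank l) := rfl

lemma rank_mono (l : List ℕ) : Monotone (rank l) := by
  intro x y hxy
  refine (List.monotone_filter_right l fun z hz => ?_).length_le
  simp only [decide_eq_true_eq] at hz ⊢
  omega

lemma rank_lt_rank {l : List ℕ} {x y : ℕ} (hy : y ∈ l) (hxy : x < y) : rank l x < rank l y := by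
  have key : (l.filter fun z => decide (z ≤ x)).Sublist (l.filter fun z => decide (z ≤ y)) := by
    refine List.monotone_filter_right l fun z hz => ?_
    simp only [decide_eq_true_eq] at hz ⊢
    omega
  refine lt_of_le_of_ne key.length_le fun h => ?_
  have hmem : y ∈ l.filter fun z => decide (z ≤ x) := by
    rw [key.eq_of_length h]
    simpa using hy
  simp at hmem
  omega

lemma rank_lt_rank_iff {l : List ℕ} {x y : ℕ} (hy : y ∈ l) : rank l x < rank l y ↔ x < y :=
  ⟨fun h => lt_of_not_ge fun h' => absurd (rank_mono l h') (not_le.2 h), rank_lt_rank hy⟩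

lemma std_perm_idSeq {l : List ℕ} (hl : l.Nodup) : (std l).Perm (idSeq (std l).length) := by
  rw [std_eq_map_rank]
  refine (List.subperm_of_subset ?_ ?_).perm_of_length_le (by rw [length_idSeq])
  · refine hl.map_on fun x hx y hy h => ?_
    rcases lt_trichotomy x y with h' | h' | h'
    · exact absurd h (rank_lt_rank hy h').ne
    · exact h'
    · exact absurd h (rank_lt_rank hx h').ne'
  · intro v hv
    obtain ⟨x, hx, rfl⟩ := List.mem_map.1 hv
    rw [mem_idSeq, List.length_map]
    refine ⟨?_, List.length_filter_le _ _⟩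
    exact List.length_pos_of_mem (List.mem_filter.2 ⟨hx, by simp⟩)

lemma rank_idSeq {k x : ℕ} (hx : x ≤ k) : rank (idSeq k) x = x := by
  have e : idSeq k = List.range' 1 x ++ List.range' (1 + x) (k - x) := by
    rw [idSeq_eq_range', List.range'_append_1]
    congr 1
    omega
  rw [rank, e, List.filter_append, List.filter_eq_self.2, List.filter_eq_nil_iff.2]
  · simp
  · intro y hy
    rw [List.mem_range'_1] at hy
    simp only [decide_eq_true_eq]
    omega
  · intro y hy
    rw [List.mem_range'_1] at hy
    simp only [decide_eq_true_eq]
    omega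

lemma std_eq_self {q : List ℕ} (hq : q.Perm (idSeq q.length)) : std q = q := by
  rw [std_eq_map_rank]
  conv_rhs => rw [← List.map_id q]
  refine List.map_congr_left fun x hx => ?_
  have hx' := mem_idSeq.1 (hq.mem_iff.1 hx)
  exact (hq.filter _).length_eq.trans (rank_idSeq hx'.2)

lemma std_map {q : List ℕ} {F : ℕ → ℕ} (hF : ∀ a ∈ q, ∀ b ∈ q, F a ≤ F b ↔ a ≤ b) :
    std (q.map F) = std q := by
  rw [std_eq_map_rank, std_eq_map_rank, List.map_map]
  refine List.map_congr_left fun x hx => ?_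
  simp only [Function.comp, rank, List.filter_map, List.length_map]
  congr 1
  refine List.filter_congr fun y hy => ?_
  simp [hF y hy x hx]

/-- The Boolean relation saying that the second entry is the successor of the first. -/
def isSucc (a b : ℕ) : Bool := decide (b = a + 1)

lemma isChain_range' (a k : ℕ) : (List.range' a k).IsChain fun x y => isSucc x y := by
  rw [List.isChain_iff_getElem]
  intro i hi
  simp [isSucc]
  omega

lemma eq_range'_of_isChain {m : List ℕ} (h : m.IsChain fun x y => isSucc x y) :
    m = List.range' m.headI m.length := by
  induction m with
  | nil => rfl
  | cons a m ih =>
    rw [List.length_cons, List.headI_cons, List.range'_succ]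
    congr 1
    rcases m with _ | ⟨b, m⟩
    · rfl
    · rw [List.isChain_cons_cons] at h
      have hb : b = a + 1 := by simpa [isSucc] using h.1
      rw [← hb]
      exact ih h.2

lemma incAvoid_iff_isChain {l : List ℕ} : IncAvoid l ↔ l.IsChain fun x y => y ≠ x + 1 := by
  rw [List.isChain_iff_getElem]
  rfl

lemma offset_lt_offset {q c : List ℕ} (hq : q.Nodup) (hl : q.length = c.length)
    (hc : ∀ x ∈ c, 0 < x) {u v : ℕ} (hu : u ∈ q) (huv : u < v) :
    offset (q.zip c) u < offset (q.zip c) v := by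
  have hfst : (q.zip c).map Prod.fst = q := List.map_fst_zip hl.le
  have hu' := hu
  rw [← hfst] at hu'
  obtain ⟨p, hp, rfl⟩ := List.mem_map.1 hu'
  have h₁ := offset_succ (by rwa [hfst]) hp
  have h₂ := hc p.2 (List.of_mem_zip hp).2
  have h₃ := offset_mono (q.zip c) (Nat.succ_le_of_lt huv)
  simp only [Nat.succ_eq_add_one] at h₃
  omega

lemma splitBy_expand {q c : List ℕ} (hq : q.Perm (idSeq q.length)) (hi : IncAvoid q)
    (hl : q.length = c.length) (hc : ∀ x ∈ c, 0 < x) :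
    (expand q c).splitBy isSucc =
      (q.zip c).map fun p => List.range' (offset (q.zip c) p.1 + 1) p.2 := by
  have hnd : q.Nodup := hq.nodup_iff.2 (nodup_idSeq _)
  have hfst : (q.zip c).map Prod.fst = q := List.map_fst_zip hl.le
  have hpos : ∀ p ∈ q.zip c, 0 < p.2 := fun p hp => hc p.2 (List.of_mem_zip hp).2
  rw [expand_eq, List.flatMap_def]
  refine List.splitBy_flatten ?_ ?_ ?_
  · intro h
    obtain ⟨p, hp, h⟩ := List.mem_map.1 h
    have := hpos p hp
    rw [List.range'_eq_nil_iff] at h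
    omega
  · intro m hm
    obtain ⟨p, -, rfl⟩ := List.mem_map.1 hm
    exact isChain_range' _ _
  · rw [List.isChain_map]
    have hi' := incAvoid_iff_isChain.1 hi
    rw [← hfst, List.isChain_map] at hi'
    refine List.IsChain.imp_of_mem_imp (fun p r hp hr hpr => ?_) hi'
    have hp₂ := hpos p hp
    have hr₂ := hpos r hr
    refine ⟨by simp; omega, by simp; omega, ?_⟩
    have hs := offset_succ (by rwa [hfst]) hp
    have hpq := mem_idSeq.1 (hq.mem_iff.1 (List.of_mem_zip hp).1)
    have hrq := mem_idSeq.1 (hq.mem_iff.1 (List.of_mem_zip hr).1)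
    have hne : offset (q.zip c) r.1 ≠ offset (q.zip c) p.1 + p.2 := by
      rcases lt_or_ge (p.1 + 1) r.1 with h | h
      · have hmem : p.1 + 1 ∈ q := hq.mem_iff.2 (mem_idSeq.2 ⟨by omega, by omega⟩)
        have := offset_lt_offset hnd hl hc hmem h
        omega
      · have := offset_mono (q.zip c) (show r.1 ≤ p.1 by omega)
        omega
    simp only [isSucc, List.getLast_range', List.head_range', decide_eq_false_iff_not]
    omega

lemma expand_injective {q c q' c' : List ℕ}
    (hq : q.Perm (idSeq q.length)) (hi : IncAvoid q) (hl : q.length = c.length)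
    (hc : ∀ x ∈ c, 0 < x)
    (hq' : q'.Perm (idSeq q'.length)) (hi' : IncAvoid q') (hl' : q'.length = c'.length)
    (hc' : ∀ x ∈ c', 0 < x) (h : expand q c = expand q' c') : q = q' ∧ c = c' := by
  have key := congrArg (List.splitBy isSucc) h
  rw [splitBy_expand hq hi hl hc, splitBy_expand hq' hi' hl' hc'] at key
  have lengths : ∀ {q c : List ℕ}, q.length = c.length →
      ((q.zip c).map fun p => List.range' (offset (q.zip c) p.1 + 1) p.2).map List.length = c := by
    intro q c hl
    rw [List.map_map]
    conv_rhs => rw [← List.map_snd_zip hl.ge]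
    exact List.map_congr_left fun p _ => by simp
  have heads : ∀ {q c : List ℕ}, q.Perm (idSeq q.length) → q.length = c.length →
      (∀ x ∈ c, 0 < x) →
      std (((q.zip c).map fun p => List.range' (offset (q.zip c) p.1 + 1) p.2).map List.headI)
        = q := by
    intro q c hq hl hc
    have hnd : q.Nodup := hq.nodup_iff.2 (nodup_idSeq _)
    have e : ((q.zip c).map fun p => List.range' (offset (q.zip c) p.1 + 1) p.2).map List.headI
        = q.map fun v => offset (q.zip c) v + 1 := by
      conv_rhs => rw [← List.map_fst_zip hl.le, List.map_map, List.map_fst_zip hl.le]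
      rw [List.map_map]
      refine List.map_congr_left fun p hp => ?_
      obtain ⟨k, hk⟩ := Nat.exists_eq_succ_of_ne_zero (hc p.2 (List.of_mem_zip hp).2).ne'
      simp [hk, List.range'_succ]
    rw [e, std_map, std_eq_self hq]
    intro a _ b hb
    rw [Nat.add_le_add_iff_right]
    refine ⟨fun h => ?_, fun h => offset_mono _ h⟩
    by_contra hab
    exact absurd h (not_le.2 (offset_lt_offset hnd hl hc hb (not_le.1 hab)))
  constructor
  · rw [← heads hq hl hc, key, heads hq' hl' hc']
  · rw [← lengths hl, key, lengths hl']

lemma map_headI_sublist_flatten {L : List (List ℕ)} (hL : ∀ m ∈ L, m ≠ []) :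
    (L.map List.headI).Sublist L.flatten := by
  induction L with
  | nil => simp
  | cons m L ih =>
    simp only [List.mem_cons, forall_eq_or_imp] at hL
    obtain ⟨x, m, rfl⟩ := List.exists_cons_of_ne_nil hL.1
    exact ((ih hL.2).trans (List.sublist_append_right m _)).cons_cons x

lemma filter_mem_eq_of_sublist {H l : List ℕ} (h : H.Sublist l) (hl : l.Nodup) :
    (l.filter fun x => decide (x ∈ H)) = H := by
  have hs : H.Sublist (l.filter fun x => decide (x ∈ H)) := by
    have := h.filter fun x => decide (x ∈ H)
    rwa [List.filter_eq_self.2 (by simp)] at this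
  refine (hs.eq_of_length_le ?_).symm
  refine (List.subperm_of_subset (hl.filter _) fun x hx => ?_).length_le
  simpa using (List.mem_filter.1 hx).2

lemma length_filter_lt {l : List ℕ} (hl : l.Perm (idSeq l.length)) {h : ℕ} (hh : h ∈ l) :
    (l.filter fun x => decide (x < h)).length + 1 = h := by
  have hh' := mem_idSeq.1 (hl.mem_iff.1 hh)
  have e : (l.filter fun x => decide (x < h)) = l.filter fun x => decide (x ≤ h - 1) :=
    List.filter_congr fun x _ => by
      rw [decide_eq_decide]
      omega
  have := (hl.filter fun x => decide (x ≤ h - 1)).length_eq.trans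
    (rank_idSeq (show h - 1 ≤ l.length by omega))
  rw [e, this]
  omega

lemma sum_length_filter_headI {L : List (List ℕ)} {h : ℕ}
    (hL : ∀ m ∈ L, m ≠ [] ∧ m = List.range' m.headI m.length ∧ (h ∈ m → m.headI = h)) :
    ((L.filter fun m => decide (m.headI < h)).map List.length).sum =
      (L.flatten.filter fun x => decide (x < h)).length := by
  induction L with
  | nil => rfl
  | cons m L ih =>
    simp only [List.mem_cons, forall_eq_or_imp] at hL
    obtain ⟨⟨hne, hm, hh⟩, hL⟩ := hL
    have hpos := List.length_pos_of_ne_nil hne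
    have hmem : ∀ x, x ∈ m ↔ m.headI ≤ x ∧ x < m.headI + m.length := fun x => by
      conv_lhs => rw [hm]
      rw [List.mem_range'_1]
    rw [List.flatten_cons, List.filter_append, List.length_append, ← ih hL]
    rw [hmem h] at hh
    by_cases hlt : m.headI < h
    · rw [List.filter_cons_of_pos (by simpa using hlt), List.map_cons, List.sum_cons,
        (List.filter_eq_self (l := m)).2 fun x hx => ?_]
      have := (hmem x).1 hx
      simp only [decide_eq_true_eq]
      omega
    · rw [List.filter_cons_of_neg (by simpa using hlt),
        (List.filter_eq_nil_iff (l := m)).2 fun x hx => ?_]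
      · simp
      · have := (hmem x).1 hx
        simp only [decide_eq_true_eq]
        omega

/-- Erasing from an achievable permutation all entries outside a sublist and standardizing
gives an achievable permutation. -/
lemma AchList.std_of_sublist {l H : List ℕ} (ha : AchList l) (hl : l.Perm (idSeq l.length))
    (hH : H.Sublist l) : AchList (std H) := by
  have hnd : l.Nodup := hl.nodup_iff.2 (nodup_idSeq _)
  have hf : ∀ k : List ℕ, k.flatMap (fun x => if x ∈ H then [rank H x] else []) =
      (k.filter fun x => decide (x ∈ H)).map (rank H) := by
    intro k
    induction k with
    | nil => rfl
    | cons x k ih => by_cases hx : x ∈ H <;> simp [hx, ih]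
  have hl' : l.flatMap (fun x => if x ∈ H then [rank H x] else []) = std H := by
    rw [hf, filter_mem_eq_of_sublist hH hnd, std_eq_map_rank]
  rw [← hl']
  refine ha.flatMap _ ?_
  refine List.Perm.eq_of_pairwise (le := (· < ·)) (fun a b _ _ h h' => absurd h h'.asymm) ?_
    (pairwise_idSeq _) ?_
  · rw [hf, List.pairwise_map]
    refine ((pairwise_idSeq _).filter _).imp_of_mem fun {a b} _ hb hab => rank_lt_rank ?_ hab
    simpa using (List.mem_filter.1 hb).2
  · refine (hl.symm.flatMap_right _).trans ?_
    rw [hl']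
    exact std_perm_idSeq (hnd.sublist hH)

lemma exists_expand_eq {l : List ℕ} (ha : AchList l) (hl : l.Perm (idSeq l.length)) :
    ∃ q c : List ℕ, (AchList q ∧ q.Perm (idSeq q.length) ∧ IncAvoid q ∧
      q.length = c.length ∧ (∀ x ∈ c, 0 < x) ∧ c.sum = l.length) ∧ expand q c = l := by
  have hnd : l.Nodup := hl.nodup_iff.2 (nodup_idSeq _)
  set L := l.splitBy isSucc with hL
  have hflat : L.flatten = l := List.flatten_splitBy _ _
  have hne : ∀ m ∈ L, m ≠ [] := fun m hm => List.ne_nil_of_mem_splitBy hm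
  have hrun : ∀ m ∈ L, m = List.range' m.headI m.length := fun m hm =>
    eq_range'_of_isChain (List.isChain_of_mem_splitBy hm)
  have hsub : (L.map List.headI).Sublist l := hflat ▸ map_headI_sublist_flatten hne
  have hmem : ∀ m ∈ L, m.headI ∈ m := fun m hm => by
    obtain ⟨x, m, rfl⟩ := List.exists_cons_of_ne_nil (hne m hm)
    simp
  have hdisj : ∀ m ∈ L, ∀ m' ∈ L, m'.headI ∈ m → m.headI = m'.headI := by
    intro m hm m' hm' h
    by_contra hh
    have hp := (List.nodup_flatten.1 (hflat ▸ hnd)).2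
    have : Std.Symm (List.Disjoint (α := ℕ)) := ⟨fun _ _ h => h.symm⟩
    exact hp.forall hm hm' (fun e => hh (by rw [e])) h (hmem m' hm')
  set H := L.map List.headI with hH
  set g : List ℕ → ℕ := fun m => rank H m.headI with hg
  have hstd : std H = L.map g := by
    rw [std_eq_map_rank, hH, List.map_map]
    rfl
  have hzip : (L.map g).zip (L.map List.length) = L.map fun m => (g m, m.length) :=
    List.zip_map'
  have hoff : ∀ m ∈ L,
      offset ((L.map g).zip (L.map List.length)) (g m) + 1 = m.headI := by
    intro m hm
    have hlt : ∀ m' ∈ L, decide (g m' < g m) = decide (m'.headI < m.headI) := fun m' _ =>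
      decide_eq_decide.2 (rank_lt_rank_iff (List.mem_map_of_mem hm))
    rw [offset, hzip, List.filter_map, List.map_map]
    simp only [Function.comp_def]
    rw [List.filter_congr hlt, sum_length_filter_headI fun m' hm' =>
      ⟨hne m' hm', hrun m' hm', hdisj m' hm' m hm⟩, hflat]
    exact length_filter_lt hl (hsub.subset (List.mem_map_of_mem hm))
  have hperm : (L.map g).Perm (idSeq (L.map g).length) :=
    hstd ▸ std_perm_idSeq (hnd.sublist hsub)
  refine ⟨L.map g, L.map List.length, ⟨hstd ▸ ha.std_of_sublist hl hsub, hperm, ?_, by simp, ?_, ?_⟩,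
    ?_⟩
  · rw [incAvoid_iff_isChain, List.isChain_map]
    refine List.IsChain.imp_of_mem_imp (fun m m' hm hm' h e => ?_)
      (List.isChain_getLast_head_splitBy isSucc l)
    obtain ⟨hm₀, hm₀', h⟩ := h
    have hs := offset_succ (P := (L.map g).zip (L.map List.length)) (p := (g m, m.length))
      (by
        rw [List.map_fst_zip (by simp)]
        exact hperm.nodup_iff.2 (nodup_idSeq _))
      (by
        rw [hzip]
        exact List.mem_map_of_mem hm)
    have h₁ := hoff m hm
    have h₂ := hoff m' hm'
    have hlast : m.getLast hm₀ = m.headI + m.length - 1 := by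
      have key : ∀ (k : List ℕ) (hk : k ≠ []) (a r : ℕ), k = List.range' a r →
          k.getLast hk = a + r - 1 := by
        rintro k hk a r rfl
        simp
      exact key m hm₀ _ _ (hrun m hm)
    have hhead : m'.head hm₀' = m'.headI := by
      obtain ⟨x, m', rfl⟩ := List.exists_cons_of_ne_nil hm₀'
      rfl
    have hpos := List.length_pos_of_ne_nil hm₀
    simp only [isSucc, decide_eq_false_iff_not, hlast, hhead] at h
    rw [e] at h₂
    simp only at hs
    omega
  · intro x hx
    obtain ⟨m, hm, rfl⟩ := List.mem_map.1 hx
    exact List.length_pos_of_ne_nil (hne m hm)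
  · rw [← List.length_flatten, hflat]
  · rw [expand_eq]
    conv_lhs =>
      arg 2
      rw [hzip]
    rw [List.flatMap_map]
    conv_rhs => rw [← hflat, ← List.flatMap_id]
    refine List.flatMap_congr fun m hm => ?_
    rw [hoff m hm]
    exact (hrun m hm).symm

theorem contraction_bijection (n : ℕ) (hn : 1 ≤ n) :
    (∀ q c : List ℕ, AchList q → q.Perm (idSeq q.length) → IncAvoid q →
        q.length = c.length → (∀ x ∈ c, 0 < x) → c.sum = n →
        AchList (expand q c) ∧ (expand q c).Perm (idSeq n)) ∧
    (∀ l : List ℕ, AchList l → l.Perm (idSeq n) →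
      ∃! qc : List ℕ × List ℕ,
        (AchList qc.1 ∧ qc.1.Perm (idSeq qc.1.length) ∧ IncAvoid qc.1 ∧
          qc.1.length = qc.2.length ∧ (∀ x ∈ qc.2, 0 < x) ∧ qc.2.sum = n) ∧
        expand qc.1 qc.2 = l) := by
  refine ⟨fun q c ha hq _ hl _ hn => ⟨achList_expand ha hq hl, hn ▸ expand_perm hq hl⟩,
    fun l ha hl => ?_⟩
  obtain rfl : l.length = n := hl.length_eq.trans (length_idSeq n)
  obtain ⟨q, c, hqc, he⟩ := exists_expand_eq ha hl
  refine ⟨(q, c), ⟨hqc, he⟩, ?_⟩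
  rintro ⟨q', c'⟩ ⟨⟨-, hq', hi', hl', hc', -⟩, he'⟩
  obtain ⟨-, hq, hi, hl, hc, -⟩ := hqc
  obtain ⟨rfl, rfl⟩ := expand_injective hq' hi' hl' hc' hq hi hl hc (he'.trans he.symm)
  rfl

end TwoStacks
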